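/- Let C_ψ be a d-dimensional Archimedean copula (d ≥ 2) with d-monotone generator ψ and pseudoinverse φ, and let ℓ ∈ {1,…,d−1}. Define K_ψ : [0,1]^ℓ × B([0,1]^{d−ℓ}) → [0,1] on rectangles by: K_ψ(x,[0,y]) = 1 if min(x)=1 or x ∈ L₀^{1:ℓ}; K_ψ(x,[0,y]) = 0 if min(x) ∈ (0,1), x ∉ L₀^{1:ℓ} and (x,y) ∈ int L₀; and K_ψ(x,[0,y]) = ψ^{(ℓ)}(Σ_{i=1}^ℓ φ(x_i) + Σ_{j=1}^{d−ℓ} φ(y_j)) / ψ^{(ℓ)}(Σ_{i=1}^ℓ φ(x_i)) otherwise (where for ℓ = d−1 the derivative ψ^{(d−1)} is replaced by the left-hand derivative D⁻ψ^{(d−2)}). Then K_ψ extends to a Markov kernel from [0,1]^ℓ to [0,1]^{d−ℓ} which is a version of the ℓ-Markov kernel of C_ψ, i.e. μ_{C_ψ}([0,x]×[0,y]) = ∫_{[0,x]} K_ψ(s,[0,y]) dμ_{C_ψ^{1:ℓ}}(s) for all (x,y) ∈ [0,1]^ℓ × [0,1]^{d−ℓ}. -/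

import Mathlib

open MeasureTheory ProbabilityTheory Set Filter Topology
open scoped ENNReal

noncomputable section
attribute [local instance] Classical.propDecidable

/-- The lower-orthant box `[0, y] = [0,y₁] × ⋯ × [0,y_k]` (as a lower set in `ℝ^k`;
all measures considered are supported on the unit cube). -/
def lowerBox {k : ℕ} (y : Fin k → ℝ) : Set (Fin k → ℝ) := {t | ∀ i, t i ≤ y i}

/-- The closed unit cube `[0,1]^k`. -/
def unitCube (k : ℕ) : Set (Fin k → ℝ) := {t | ∀ i, t i ∈ Icc (0 : ℝ) 1}

/-- Evaluation of a generator `ψ` at an extended-real argument, with `ψ(∞) = 0`. -/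
def evalPsi (ψ : ℝ → ℝ) (s : ℝ≥0∞) : ℝ := if s = ∞ then 0 else ψ s.toReal

/-- `ψ^{(ℓ)}(s)`, with `ψ^{(ℓ)}` replaced by the left-hand derivative `D⁻ψ^{(d−2)}`
when `ℓ = d − 1`, and extended by `0` at `s = ∞`. -/
def psiD (d l : ℕ) (ψ : ℝ → ℝ) (s : ℝ≥0∞) : ℝ :=
  if s = ∞ then 0
  else if l = d - 1 then derivWithin (iteratedDeriv (d - 2) ψ) (Iio s.toReal) s.toReal
  else iteratedDeriv l ψ s.toReal

/-- `ψ` is a `d`-monotone Archimedean generator, with pseudoinverse `φ`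
(valued in `ℝ≥0∞`; `φ 0 = inf{z : ψ(z) = 0}` which equals `∞` iff the generator is strict). -/
structure IsGenerator (d : ℕ) (ψ : ℝ → ℝ) (φ : ℝ → ℝ≥0∞) : Prop where
  continuousOn : ContinuousOn ψ (Ici 0)
  at_zero : ψ 0 = 1
  tendsto_zero : Tendsto ψ atTop (nhds 0)
  nonneg : ∀ z : ℝ, 0 ≤ z → 0 ≤ ψ z
  antitoneOn : AntitoneOn ψ (Ici 0)
  strict_anti : ∀ z₁ z₂ : ℝ, 0 ≤ z₁ → z₁ < z₂ → 0 < ψ z₂ → ψ z₂ < ψ z₁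
  smooth : ∀ z : ℝ, 0 < z → ContDiffAt ℝ ((d - 2 : ℕ) : ℕ∞) ψ z
  alt_sign : ∀ m : ℕ, m ≤ d - 2 → ∀ z : ℝ, 0 < z → 0 ≤ (-1 : ℝ) ^ m * iteratedDeriv m ψ z
  top_antitone : AntitoneOn (fun z => (-1 : ℝ) ^ (d - 2) * iteratedDeriv (d - 2) ψ z) (Ioi 0)
  top_convex : ConvexOn ℝ (Ioi 0) (fun z => (-1 : ℝ) ^ (d - 2) * iteratedDeriv (d - 2) ψ z)
  phi_finite : ∀ t : ℝ, 0 < t → φ t ≠ ∞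
  phi_one : φ 1 = 0
  phi_antitoneOn : AntitoneOn φ (Ioc 0 1)
  psi_phi : ∀ t : ℝ, 0 < t → t ≤ 1 → evalPsi ψ (φ t) = t
  phi_zero : φ 0 = sInf {s : ℝ≥0∞ | evalPsi ψ s = 0}

/-- The explicit formula for the `ℓ`-Markov kernel of the Archimedean copula generated by
`ψ`, evaluated at the box `[0,y]`.  The first case is `min(x) = 1` or `x ∈ L₀^{1:ℓ}`
(the latter meaning `C^{1:ℓ}(x) = ψ(Σᵢφ(xᵢ)) = 0`); the second case is
`(x,y) ∈ int L₀` (i.e. `Σᵢφ(xᵢ) + Σⱼφ(yⱼ) > φ(0) = inf{z : ψ(z) = 0}`); the third case is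
the ratio `ψ^{(ℓ)}(Σᵢφ(xᵢ) + Σⱼφ(yⱼ)) / ψ^{(ℓ)}(Σᵢφ(xᵢ))`. -/
def archK (d l : ℕ) (ψ : ℝ → ℝ) (φ : ℝ → ℝ≥0∞) (x : Fin l → ℝ) (y : Fin (d - l) → ℝ) : ℝ :=
  if (∀ i, x i = 1) ∨ evalPsi ψ (∑ i, φ (x i)) = 0 then 1
  else if ∃ t : ℝ≥0∞, t < (∑ i, φ (x i)) + ∑ j, φ (y j) ∧ evalPsi ψ t = 0 then 0
  else psiD d l ψ ((∑ i, φ (x i)) + ∑ j, φ (y j)) / psiD d l ψ (∑ i, φ (x i))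

/-- `K` disintegrates `μ` over its first marginal:
`μ(G) = ∫ K(x, G_x) dμ^{1:ℓ}(x)` for every Borel set `G`. -/
def IsDisintegration {α β : Type*} [MeasurableSpace α] [MeasurableSpace β]
    (μ : Measure (α × β)) (K : Kernel α β) : Prop :=
  ∀ G : Set (α × β), MeasurableSet G →
    μ G = ∫⁻ a, K a (Prod.mk a ⁻¹' G) ∂(μ.map Prod.fst)

def gM (d m : ℕ) (ψ : ℝ → ℝ) (a : ℝ) : ℝ :=
  (-1 : ℝ) ^ m * (if m = d - 1 then derivWithin (iteratedDeriv (d - 2) ψ) (Iio a) a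
    else iteratedDeriv m ψ a)

lemma gM_of_le {d m : ℕ} (hd : 2 ≤ d) (hm : m ≤ d - 2) (ψ : ℝ → ℝ) :
    gM d m ψ = fun a => (-1 : ℝ) ^ m * iteratedDeriv m ψ a := by
  funext a
  have : m ≠ d - 1 := by omega
  simp [gM, this]

lemma gM_zero {d : ℕ} (hd : 2 ≤ d) (ψ : ℝ → ℝ) : gM d 0 ψ = ψ := by
  rw [gM_of_le hd (by omega)]; simp

section Analysis
variable {d : ℕ} {ψ : ℝ → ℝ} {φ : ℝ → ℝ≥0∞}

lemma gen_contDiffOn (h : IsGenerator d ψ φ) : ContDiffOn ℝ ((d - 2 : ℕ) : ℕ∞) ψ (Ioi 0) :=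
  fun x hx => (h.smooth x hx).contDiffWithinAt

lemma gM_continuousOn (hd : 2 ≤ d) (h : IsGenerator d ψ φ) {m : ℕ} (hm : m ≤ d - 2) :
    ContinuousOn (gM d m ψ) (Ioi 0) := by
  rw [gM_of_le hd hm]
  refine continuousOn_const.mul ?_
  have := (gen_contDiffOn h).continuousOn_iteratedDerivWithin (m := m) (by exact_mod_cast hm)
    (uniqueDiffOn_Ioi 0)
  exact this.congr fun x hx => (iteratedDerivWithin_of_isOpen isOpen_Ioi hx).symm

lemma gM_hasDerivAt (hd : 2 ≤ d) (h : IsGenerator d ψ φ) {m : ℕ} (hm : m + 1 ≤ d - 2) {a : ℝ}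
    (ha : 0 < a) : HasDerivAt (gM d m ψ) (-(gM d (m + 1) ψ a)) a := by
  rw [gM_of_le hd (by omega), gM_of_le hd hm]
  have h1 := (gen_contDiffOn h).differentiableOn_iteratedDerivWithin (m := m)
    (by exact_mod_cast (by omega : m < d - 2)) (uniqueDiffOn_Ioi 0)
  have h2 : DifferentiableOn ℝ (iteratedDeriv m ψ) (Ioi 0) :=
    h1.congr fun x hx => (iteratedDerivWithin_of_isOpen isOpen_Ioi hx).symm
  have h3 := ((h2.differentiableAt (Ioi_mem_nhds ha)).hasDerivAt).const_mul ((-1 : ℝ) ^ m)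
  have e : -((-1 : ℝ) ^ (m + 1) * iteratedDeriv (m + 1) ψ a)
      = (-1) ^ m * deriv (iteratedDeriv m ψ) a := by
    rw [iteratedDeriv_succ]; ring
  simp only [e]
  exact h3

lemma gM_top (hd : 2 ≤ d) (a : ℝ) :
    gM d (d - 1) ψ a = - derivWithin (gM d (d - 2) ψ) (Iio a) a := by
  rw [gM_of_le hd le_rfl, derivWithin_const_mul_field]
  have : d - 1 = (d - 2) + 1 := by omega
  simp only [gM, if_true]
  rw [this, pow_succ]; ring

lemma gM_convex (hd : 2 ≤ d) (h : IsGenerator d ψ φ) : ConvexOn ℝ (Ioi 0) (gM d (d - 2) ψ) := by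
  rw [gM_of_le hd le_rfl]; exact h.top_convex

lemma gM_hasDerivWithinAt (hd : 2 ≤ d) (h : IsGenerator d ψ φ) {m : ℕ} (hm : m + 1 ≤ d - 1) {a : ℝ}
    (ha : 0 < a) : HasDerivWithinAt (gM d m ψ) (-(gM d (m + 1) ψ a)) (Iio a) a := by
  by_cases hm' : m + 1 ≤ d - 2
  · exact (gM_hasDerivAt hd h hm' ha).hasDerivWithinAt
  · have e1 : m = d - 2 := by omega
    have e2 : m + 1 = d - 1 := by omega
    rw [e2, gM_top hd, e1, neg_neg]
    exact (gM_convex hd h).hasDerivWithinAt_leftDeriv_of_mem_interior (by simpa using ha)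

lemma gM_antitone_low (hd : 2 ≤ d) (h : IsGenerator d ψ φ) {m : ℕ} (hm : m ≤ d - 2) :
    AntitoneOn (gM d m ψ) (Ioi 0) := by
  rcases hm.eq_or_lt with rfl | hlt
  · rw [gM_of_le hd le_rfl]; exact h.top_antitone
  · refine antitoneOn_of_deriv_nonpos (convex_Ioi 0) (gM_continuousOn hd h hm) ?_ ?_
    · intro x hx
      rw [interior_Ioi] at hx
      exact (gM_hasDerivAt hd h hlt hx).differentiableAt.differentiableWithinAt
    · intro x hx
      rw [interior_Ioi] at hx
      rw [(gM_hasDerivAt hd h hlt hx).deriv, gM_of_le hd hlt]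
      have := h.alt_sign (m + 1) hlt x hx
      simpa using this

lemma gM_antitone (hd : 2 ≤ d) (h : IsGenerator d ψ φ) {m : ℕ} (hm : m ≤ d - 1) :
    AntitoneOn (gM d m ψ) (Ioi 0) := by
  by_cases hm' : m ≤ d - 2
  · exact gM_antitone_low hd h hm'
  · obtain rfl : m = d - 1 := by omega
    intro x hx y hy hxy
    rw [gM_top hd, gM_top hd]
    have := (gM_convex hd h).monotoneOn_leftDeriv
    rw [interior_Ioi] at this
    exact neg_le_neg (this hx hy hxy)

lemma gM_nonneg (hd : 2 ≤ d) (h : IsGenerator d ψ φ) {m : ℕ} (hm : m ≤ d - 1) {a : ℝ}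
    (ha : 0 < a) : 0 ≤ gM d m ψ a := by
  by_cases hm' : m ≤ d - 2
  · rw [gM_of_le hd hm']; exact h.alt_sign m hm' a ha
  · obtain rfl : m = d - 1 := by omega
    have h1 := gM_hasDerivWithinAt hd h (m := d - 2) (a := a) (by omega) ha
    have e : d - 2 + 1 = d - 1 := by omega
    rw [e] at h1
    have h2 : Tendsto (slope (gM d (d - 2) ψ) a) (𝓝[Iio a] a) (𝓝 (-gM d (d - 1) ψ a)) :=
      (hasDerivWithinAt_iff_tendsto_slope' (by simp)).1 h1
    have : -gM d (d - 1) ψ a ≤ 0 := by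
      refine le_of_tendsto h2 ?_
      have : Ioo 0 a ∈ 𝓝[<] a := Ioo_mem_nhdsLT ha
      filter_upwards [this] with x hx
      have := gM_antitone_low hd h le_rfl hx.1 (mem_Ioi.2 ha) hx.2.le
      rw [slope_def_field]
      refine div_nonpos_of_nonneg_of_nonpos (by linarith) (by linarith [hx.2])
    linarith

lemma gM_intervalIntegrable (hd : 2 ≤ d) (h : IsGenerator d ψ φ) {m : ℕ} (hm : m ≤ d - 1)
    {a b : ℝ} (ha : 0 < a) (hab : a ≤ b) : IntervalIntegrable (gM d m ψ) volume a b := by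
  apply AntitoneOn.intervalIntegrable
  refine (gM_antitone hd h hm).mono ?_
  rw [uIcc_of_le hab]
  exact fun x hx => lt_of_lt_of_le ha hx.1

lemma gM_ftc (hd : 2 ≤ d) (h : IsGenerator d ψ φ) {m : ℕ} (hm : m + 1 ≤ d - 1)
    {a b : ℝ} (ha : 0 < a) (hab : a ≤ b) :
    ∫ x in a..b, gM d (m + 1) ψ x = gM d m ψ a - gM d m ψ b := by
  have key := intervalIntegral.integral_eq_sub_of_hasDeriv_right_of_le (a := -b) (b := -a)
    (f := fun x => gM d m ψ (-x)) (f' := fun x => gM d (m + 1) ψ (-x)) (by linarith) ?_ ?_ ?_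
  · rw [intervalIntegral.integral_comp_neg] at key
    simpa using key
  · refine (gM_continuousOn hd h (by omega)).comp continuous_neg.continuousOn ?_
    intro x hx
    simp only [mem_Ioi]; linarith [hx.2]
  · intro x hx
    have h1 := gM_hasDerivWithinAt hd h hm (a := -x) (by linarith [hx.2])
    have h2 : HasDerivWithinAt (fun x : ℝ => -x) (-1) (Ioi x) x :=
      (hasDerivAt_neg x).hasDerivWithinAt
    have := h1.comp x h2 (fun y hy => by simpa using hy)
    simpa [Function.comp_def] using this
  · have := (gM_intervalIntegrable hd h hm ha hab)
    have := (IntervalIntegrable.iff_comp_neg).1 this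
    exact this.symm

lemma gM_tendsto (hd : 2 ≤ d) (h : IsGenerator d ψ φ) {m : ℕ} (hm : m ≤ d - 1) :
    Tendsto (gM d m ψ) atTop (𝓝 0) := by
  induction m with
  | zero => rw [gM_zero hd]; exact h.tendsto_zero
  | succ m ih =>
    have ih := ih (by omega)
    have h1 : Tendsto (fun x : ℝ => gM d m ψ (x - 1) - gM d m ψ x) atTop (𝓝 0) := by
      have := (ih.comp (tendsto_atTop_add_const_right atTop (-1 : ℝ) tendsto_id)).sub ih
      simpa [Function.comp_def, sub_eq_add_neg] using this
    refine tendsto_of_tendsto_of_tendsto_of_le_of_le' tendsto_const_nhds h1 ?_ ?_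
    · filter_upwards [eventually_gt_atTop 0] with x hx using gM_nonneg hd h hm hx
    · filter_upwards [eventually_gt_atTop 1] with x hx
      rw [← gM_ftc hd h hm (by linarith) (by linarith : x - 1 ≤ x)]
      have := intervalIntegral.integral_mono_on (μ := volume) (a := x - 1) (b := x)
        (f := fun _ => gM d (m + 1) ψ x) (g := gM d (m + 1) ψ) (by linarith)
        (by simp) (gM_intervalIntegrable hd h hm (by linarith) (by linarith))
        (fun y hy => gM_antitone hd h hm (mem_Ioi.2 (by linarith [hy.1]))
          (mem_Ioi.2 (by linarith)) hy.2)
      simpa using this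

lemma gM_left_cont (hd : 2 ≤ d) (h : IsGenerator d ψ φ) {a : ℝ} (ha : 0 < a) :
    ContinuousWithinAt (gM d (d - 1) ψ) (Iic a) a := by
  have hcv := gM_convex hd h
  have hanti := gM_antitone hd h (m := d - 1) le_rfl
  have hcont := gM_continuousOn hd h (m := d - 2) le_rfl
  rw [← continuousWithinAt_Iio_iff_Iic]
  rw [ContinuousWithinAt, Metric.tendsto_nhds]
  intro ε hε
  -- slope from left
  have h1 := gM_hasDerivWithinAt hd h (m := d - 2) (a := a) (by omega) ha
  have e : d - 2 + 1 = d - 1 := by omega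
  rw [e] at h1
  have h2 : Tendsto (slope (gM d (d - 2) ψ) a) (𝓝[Iio a] a) (𝓝 (-gM d (d - 1) ψ a)) :=
    (hasDerivWithinAt_iff_tendsto_slope' (by simp)).1 h1
  have h3 : ∀ᶠ x in 𝓝[<] a, -gM d (d - 1) ψ a - ε / 2 < slope (gM d (d - 2) ψ) a x :=
    h2.eventually (lt_mem_nhds (by linarith))
  have : Ioo 0 a ∈ 𝓝[<] a := Ioo_mem_nhdsLT ha
  obtain ⟨x, hx1, hx2⟩ := (h3.and this).exists
  have h4 : Tendsto (fun y => slope (gM d (d - 2) ψ) x y) (𝓝[<] a)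
      (𝓝 (slope (gM d (d - 2) ψ) x a)) := by
    have hc : ContinuousAt (fun y => slope (gM d (d - 2) ψ) x y) a := by
      have : (fun y => slope (gM d (d - 2) ψ) x y) =
        fun y => (gM d (d - 2) ψ y - gM d (d - 2) ψ x) / (y - x) := by
        funext y; rw [slope_def_field]
      rw [this]
      refine ContinuousAt.div ?_ (by fun_prop) (by linarith [hx2.2])
      exact (hcont.continuousAt (Ioi_mem_nhds ha)).sub continuousAt_const
    exact hc.mono_left nhdsWithin_le_nhds
  rw [slope_comm] at hx1
  have h5 := h4.eventually (lt_mem_nhds hx1)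
  filter_upwards [h5, Ioo_mem_nhdsLT hx2.2] with y hy1 hy2
  have hy0 : 0 < y := hx2.1.trans hy2.1
  have h6 : slope (gM d (d - 2) ψ) x y ≤ -gM d (d - 1) ψ y := by
    rw [gM_top hd, neg_neg]
    exact hcv.slope_le_leftDeriv_of_mem_interior (by exact hx2.1)
      (by simpa using hy0) hy2.1
  have h7 := hanti (mem_Ioi.2 hy0) (mem_Ioi.2 ha) hy2.2.le
  rw [Real.dist_eq, abs_lt]
  constructor <;> linarith

end Analysis

def HH (d m : ℕ) (ψ : ℝ → ℝ) (a : ℝ) : ℝ≥0∞ :=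
  if 0 < a then ENNReal.ofReal (gM d m ψ a) else if a = 0 ∧ m = 0 then 1 else ⊤

section HHsec
variable {d : ℕ} {ψ : ℝ → ℝ} {φ : ℝ → ℝ≥0∞}

lemma HH_pos {m : ℕ} {a : ℝ} (ha : 0 < a) : HH d m ψ a = ENNReal.ofReal (gM d m ψ a) := by
  simp [HH, ha]

lemma HH_ne_top {m : ℕ} {a : ℝ} (ha : 0 < a) : HH d m ψ a ≠ ⊤ := by
  simp [HH, ha]

lemma psi_le_one (h : IsGenerator d ψ φ) {a : ℝ} (ha : 0 ≤ a) : ψ a ≤ 1 := by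
  rw [← h.at_zero]; exact h.antitoneOn (mem_Ici.2 le_rfl) ha ha

lemma HH_zero (hd : 2 ≤ d) (h : IsGenerator d ψ φ) {a : ℝ} (ha : 0 ≤ a) :
    HH d 0 ψ a = ENNReal.ofReal (ψ a) := by
  rcases ha.eq_or_lt with rfl | ha
  · simp [HH, h.at_zero]
  · rw [HH_pos ha, gM_zero hd]

lemma HH_antitone (hd : 2 ≤ d) (h : IsGenerator d ψ φ) {m : ℕ} (hm : m ≤ d - 1) :
    Antitone (HH d m ψ) := by
  intro x y hxy
  by_cases hx : 0 < x
  · rw [HH_pos hx, HH_pos (hx.trans_le hxy)]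
    exact ENNReal.ofReal_le_ofReal (gM_antitone hd h hm hx (mem_Ioi.2 (hx.trans_le hxy)) hxy)
  · by_cases hx0 : x = 0 ∧ m = 0
    · obtain ⟨rfl, rfl⟩ := hx0
      rw [HH_zero hd h le_rfl, HH_zero hd h hxy]
      exact ENNReal.ofReal_le_ofReal (h.antitoneOn (mem_Ici.2 le_rfl) hxy hxy)
    · have : HH d m ψ x = ⊤ := by simp only [HH, if_neg hx, if_neg hx0]
      rw [this]; exact le_top

lemma HH_measurable (hd : 2 ≤ d) (h : IsGenerator d ψ φ) {m : ℕ} (hm : m ≤ d - 1) :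
    Measurable (HH d m ψ) := (HH_antitone hd h hm).measurable

lemma HH_lintegral_Ioc (hd : 2 ≤ d) (h : IsGenerator d ψ φ) {m : ℕ} (hm : m + 1 ≤ d - 1)
    {a b : ℝ} (ha : 0 < a) (hab : a ≤ b) :
    ∫⁻ x in Ioc a b, HH d (m + 1) ψ x = ENNReal.ofReal (gM d m ψ a - gM d m ψ b) := by
  rw [← gM_ftc hd h hm ha hab, intervalIntegral.integral_of_le hab,
    ofReal_integral_eq_lintegral_ofReal]
  · refine setLIntegral_congr_fun measurableSet_Ioc fun x hx => ?_
    exact HH_pos (ha.trans hx.1)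
  · exact ((intervalIntegrable_iff_integrableOn_Ioc_of_le hab).1
      (gM_intervalIntegrable hd h hm ha hab))
  · refine (ae_restrict_iff' measurableSet_Ioc).2 (ae_of_all _ fun x hx => ?_)
    exact gM_nonneg hd h hm (ha.trans hx.1)

lemma gM_right_tendsto (hd : 2 ≤ d) (h : IsGenerator d ψ φ) {m : ℕ} (hm : m + 1 ≤ d - 1)
    {c : ℝ} (hc : 0 < c ∨ (m = 0 ∧ 0 ≤ c)) : ContinuousWithinAt (gM d m ψ) (Ici c) c := by
  rcases hc with hc | ⟨rfl, hc⟩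
  · exact ((gM_continuousOn hd h (by omega)).continuousAt (Ioi_mem_nhds hc)).continuousWithinAt
  · rw [gM_zero hd]
    exact (h.continuousOn c hc).mono (Ici_subset_Ici.2 hc)

lemma HH_eq_of (hd : 2 ≤ d) {m : ℕ} (h : IsGenerator d ψ φ)
    {c : ℝ} (hc : 0 < c ∨ (m = 0 ∧ 0 ≤ c)) : HH d m ψ c = ENNReal.ofReal (gM d m ψ c) := by
  rcases hc with hc | ⟨rfl, hc⟩
  · exact HH_pos hc
  · rw [HH_zero hd h hc, gM_zero hd]

lemma HH_lintegral_Ioi (hd : 2 ≤ d) (h : IsGenerator d ψ φ) {m : ℕ} (hm : m + 1 ≤ d - 1)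
    {c : ℝ} (hc : 0 < c ∨ (m = 0 ∧ 0 ≤ c)) :
    ∫⁻ x in Ioi c, HH d (m + 1) ψ x = HH d m ψ c := by
  have hc0 : 0 ≤ c := by rcases hc with h | h <;> [exact h.le; exact h.2]
  rw [HH_eq_of hd h hc]
  have t1 : Tendsto (fun n : ℕ => c + 1 / ((n : ℝ) + 1)) atTop (𝓝 c) := by
    simpa using (tendsto_one_div_add_atTop_nhds_zero_nat (𝕜 := ℝ)).const_add c
  have t2 : Tendsto (fun n : ℕ => c + 1 + (n : ℝ)) atTop atTop :=
    tendsto_atTop_add_const_left _ _ tendsto_natCast_atTop_atTop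
  have cov : AECover (volume.restrict (Ioi c)) atTop
      (fun n : ℕ => Ioc (c + 1 / ((n : ℝ) + 1)) (c + 1 + (n : ℝ))) := by
    have := (aecover_Ioi_of_Ioi (μ := (volume : Measure ℝ)) t1).inter
      ((aecover_Iic (μ := (volume : Measure ℝ)) t2).restrict (s := Ioi c))
    exact this
  refine cov.lintegral_eq_of_tendsto _ (HH_measurable hd h hm).aemeasurable ?_
  have hle : ∀ n : ℕ, c + 1 / ((n : ℝ) + 1) ≤ c + 1 + (n : ℝ) := by
    intro n
    have h1 : 1 / ((n : ℝ) + 1) ≤ 1 := by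
      rw [div_le_one (by positivity)]; linarith [(Nat.cast_nonneg n : (0 : ℝ) ≤ n)]
    linarith [(Nat.cast_nonneg n : (0 : ℝ) ≤ n)]
  have hpos : ∀ n : ℕ, c < c + 1 / ((n : ℝ) + 1) := by
    intro n
    have : 0 < 1 / ((n : ℝ) + 1) := by positivity
    linarith
  have e : ∀ n : ℕ, ∫⁻ x in Ioc (c + 1 / ((n : ℝ) + 1)) (c + 1 + (n : ℝ)), HH d (m + 1) ψ x
      ∂(volume.restrict (Ioi c))
      = ENNReal.ofReal (gM d m ψ (c + 1 / ((n : ℝ) + 1)) - gM d m ψ (c + 1 + (n : ℝ))) := by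
    intro n
    rw [Measure.restrict_restrict measurableSet_Ioc, inter_eq_left.2,
      HH_lintegral_Ioc hd h hm (hc0.trans_lt (hpos n)) (hle n)]
    intro x hx
    exact (hpos n).trans hx.1
  simp_rw [e]
  have t3 : Tendsto (fun n : ℕ => gM d m ψ (c + 1 / ((n : ℝ) + 1))) atTop (𝓝 (gM d m ψ c)) := by
    refine (gM_right_tendsto hd h hm hc).tendsto.comp ?_
    exact tendsto_nhdsWithin_iff.2 ⟨t1, Eventually.of_forall fun n => (hpos n).le⟩
  have t4 := (gM_tendsto hd h (m := m) (by omega)).comp t2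
  have := ENNReal.tendsto_ofReal (t3.sub t4)
  simpa [Function.comp_def] using this

lemma HH_lintegral_Ioi_add (hd : 2 ≤ d) (h : IsGenerator d ψ φ) {m : ℕ} (hm : m + 1 ≤ d - 1)
    {a b : ℝ} (hc : 0 < a + b ∨ (m = 0 ∧ 0 ≤ a + b)) :
    ∫⁻ x in Ioi b, HH d (m + 1) ψ (a + x) = HH d m ψ (a + b) := by
  rw [← HH_lintegral_Ioi hd h hm hc]
  have hp : MeasurePreserving (fun x : ℝ => a + x) volume volume := measurePreserving_add_left _ a
  have := hp.setLIntegral_comp_preimage (s := Ioi (a + b)) measurableSet_Ioi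
    (HH_measurable hd h hm)
  rw [← this]
  congr 2
  ext x; simp

lemma HH_lintegral_pi (hd : 2 ≤ d) (h : IsGenerator d ψ φ) (n : ℕ) : ∀ (m : ℕ),
    m + n ≤ d - 1 → ∀ (a : ℝ) (b : Fin n → ℝ), 0 ≤ a → (∀ i, 0 ≤ b i) →
    (0 < a + ∑ i, b i ∨ m = 0) →
    ∫⁻ u, HH d (m + n) ψ (a + ∑ i, u i) ∂(Measure.pi fun i => volume.restrict (Ioi (b i)))
      = HH d m ψ (a + ∑ i, b i) := by
  induction n with
  | zero =>
    intro m hm a b ha hb hc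
    rw [Measure.pi_of_empty]
    simp
  | succ n ih =>
    intro m hm a b ha hb hc
    have hmeas : ∀ a : ℝ, Measurable (fun u : Fin n → ℝ => HH d (m + (n + 1)) ψ (a + ∑ i, u i)) :=
      fun a => (HH_measurable hd h hm).comp (by fun_prop)
    rw [← ((measurePreserving_piFinSuccAbove
      (fun i => (volume : Measure ℝ).restrict (Ioi (b i))) 0).symm).lintegral_comp_emb
      (MeasurableEquiv.measurableEmbedding _)]
    rw [lintegral_prod _ (by
      apply Measurable.aemeasurable
      apply (HH_measurable hd h hm).comp
      apply Measurable.const_add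
      apply Finset.measurable_sum
      intro i _
      exact (measurable_pi_apply i).comp (MeasurableEquiv.measurable _))]
    have step : ∀ x ∈ Ioi (b 0), ∫⁻ y, HH d (m + (n + 1)) ψ
        (a + ∑ i, ((MeasurableEquiv.piFinSuccAbove (fun _ : Fin (n + 1) => ℝ) 0).symm (x, y)) i)
        ∂(Measure.pi fun j : Fin n => volume.restrict (Ioi (b (Fin.succAbove 0 j))))
        = HH d (m + 1) ψ ((a + ∑ i : Fin n, b i.succ) + x) := by
      intro x hx
      have hx0 : 0 < x := (hb 0).trans_lt hx
      have hs : 0 ≤ ∑ i : Fin n, b i.succ := Finset.sum_nonneg fun i _ => hb _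
      have := ih (m + 1) (by omega) (a + x) (fun i => b i.succ) (by linarith)
        (fun i => hb _) (Or.inl (by linarith))
      rw [show a + ∑ i : Fin n, b i.succ + x = a + x + ∑ i : Fin n, b i.succ by ring, ← this]
      have e : m + (n + 1) = m + 1 + n := by ring
      simp only [Fin.zero_succAbove]
      refine lintegral_congr fun y => ?_
      rw [e]
      congr 1
      rw [Fin.sum_univ_succ]
      simp [MeasurableEquiv.piFinSuccAbove, add_assoc]
    rw [setLIntegral_congr_fun measurableSet_Ioi step]
    have hs : 0 ≤ ∑ i : Fin n, b i.succ := Finset.sum_nonneg fun i _ => hb _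
    rw [Fin.sum_univ_succ] at hc ⊢
    rw [HH_lintegral_Ioi_add hd h (by omega)]
    · congr 1; ring
    · rcases hc with hc | hc
      · left; linarith
      · right; exact ⟨hc, by linarith [hb 0]⟩

/-- The set of integration used. -/
def posBox {n : ℕ} (b : Fin n → ℝ) : Set (Fin n → ℝ) := {u | ∀ i, 0 < u i ∧ b i ≤ u i}

lemma posBox_eq {n : ℕ} (b : Fin n → ℝ) : posBox b = Set.pi univ (fun i => Ioi 0 ∩ Ici (b i)) := by
  ext u; simp [posBox]

lemma measurableSet_posBox {n : ℕ} (b : Fin n → ℝ) : MeasurableSet (posBox b) := by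
  rw [posBox_eq]
  exact MeasurableSet.univ_pi fun i => measurableSet_Ioi.inter measurableSet_Ici

lemma HH_lintegral_posBox (hd : 2 ≤ d) (h : IsGenerator d ψ φ) (n : ℕ) (m : ℕ)
    (hm : m + n ≤ d - 1) (a : ℝ) (b : Fin n → ℝ) (ha : 0 ≤ a) (hb : ∀ i, 0 ≤ b i)
    (hc : 0 < a + ∑ i, b i ∨ m = 0) :
    ∫⁻ u in posBox b, HH d (m + n) ψ (a + ∑ i, u i) = HH d m ψ (a + ∑ i, b i) := by
  rw [← HH_lintegral_pi hd h n m hm a b ha hb hc, posBox_eq, volume_pi, Measure.restrict_pi_pi]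
  congr 2
  funext i
  apply Measure.restrict_congr_set
  have : (Ioi (0 : ℝ) ∩ Ioi (b i) : Set ℝ) =ᵐ[volume] (Ioi (0 : ℝ) ∩ Ici (b i) : Set ℝ) := (ae_eq_refl _).inter Ioi_ae_eq_Ici
  refine this.symm.trans ?_
  rw [inter_eq_right.2 (Ioi_subset_Ioi (hb i))]
  exact ae_eq_refl _

end HHsec

section Ksec
variable {d : ℕ} {ψ : ℝ → ℝ} {φ : ℝ → ℝ≥0∞}

lemma HH_ne_zero (hd : 2 ≤ d) (h : IsGenerator d ψ φ) {l : ℕ} (hl : l ≤ d - 1) {s : ℝ}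
    (hs : 0 < s) (hψ : 0 < ψ s) : HH d l ψ s ≠ 0 := by
  intro h0
  have h1 := HH_lintegral_posBox hd h l 0 (by omega) s (fun _ => 0) hs.le (fun _ => le_rfl)
    (Or.inr rfl)
  have h2 : ∫⁻ u in posBox (fun _ : Fin l => (0 : ℝ)), HH d (0 + l) ψ (s + ∑ i, u i) = 0 := by
    rw [setLIntegral_congr_fun (measurableSet_posBox _) (g := fun _ => 0)]
    · simp
    · intro u hu
      have : 0 ≤ ∑ i, u i := Finset.sum_nonneg fun i _ => (hu i).1.le
      have := HH_antitone hd h hl (by linarith : s ≤ s + ∑ i, u i)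
      rw [h0] at this
      simpa using this
  rw [h2] at h1
  simp only [Finset.sum_const_zero, add_zero] at h1
  rw [HH_zero hd h hs.le] at h1
  have := ENNReal.ofReal_eq_zero.1 h1.symm
  linarith

lemma HH_eq_zero (hd : 2 ≤ d) (h : IsGenerator d ψ φ) {t : ℝ} (ht : 0 ≤ t) (hψ : ψ t = 0)
    {l : ℕ} (hl : l ≤ d - 1) : ∀ a, t < a → HH d l ψ a = 0 := by
  induction l with
  | zero =>
    intro a ha
    rw [HH_zero hd h (ht.trans ha.le)]
    have := h.antitoneOn (mem_Ici.2 ht) (mem_Ici.2 (ht.trans ha.le)) ha.le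
    rw [hψ] at this
    simpa using this
  | succ m ih =>
    intro a ha
    have ih := ih (by omega)
    have h1 := HH_lintegral_Ioi hd h hl (c := (t + a) / 2) (Or.inl (by linarith))
    rw [ih _ (by linarith)] at h1
    have h2 : ∫⁻ x in Ioc ((t + a) / 2) a, HH d (m + 1) ψ a ≤ 0 := by
      rw [← h1]
      refine le_trans (setLIntegral_mono' measurableSet_Ioc fun x hx => ?_)
        (lintegral_mono_set (Ioc_subset_Ioi_self))
      exact HH_antitone hd h hl hx.2
    rw [setLIntegral_const, Real.volume_Ioc] at h2
    have h3 := mul_eq_zero.1 (le_antisymm h2 zero_le)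
    rcases h3 with h3 | h3
    · exact h3
    · have := ENNReal.ofReal_eq_zero.1 h3
      linarith

lemma exists_nu (hd : 2 ≤ d) (h : IsGenerator d ψ φ) {s : ℝ} (hs : 0 < s) :
    ∃ ν : Measure ℝ, SFinite ν ∧ ∀ z, 0 ≤ z → ν (Ici z) = HH d (d - 1) ψ (s + z) := by
  have hpos : ∀ x : ℝ, 0 < s + max (-x) 0 := fun x => by
    have := le_max_right (-x) 0
    linarith
  let F : StieltjesFunction ℝ :=
    { toFun := fun x => gM d (d - 1) ψ (s + max (-x) 0)
      mono' := by
        intro x y hxy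
        refine gM_antitone hd h le_rfl (mem_Ioi.2 (hpos _)) (mem_Ioi.2 (hpos _)) ?_
        gcongr
      right_continuous' := by
        intro x
        have h1 := gM_left_cont hd h (hpos x)
        refine ContinuousWithinAt.comp (f := fun x : ℝ => s + max (-x) 0) (t := Iic (s + max (-x) 0))
          h1 (Continuous.continuousWithinAt (by fun_prop)) ?_
        intro y hy
        simp only [mem_Iic]
        have : x ≤ y := hy
        gcongr }
  have hF : ∀ x, F x = gM d (d - 1) ψ (s + max (-x) 0) := fun x => rfl
  refine ⟨F.measure.map (fun x => -x), inferInstance, fun z hz => ?_⟩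
  rw [Measure.map_apply measurable_neg measurableSet_Ici]
  have e : (fun x : ℝ => -x) ⁻¹' Ici z = Iic (-z) := by
    ext x; simp only [mem_preimage, mem_Ici, mem_Iic]
    exact le_neg
  have ht : Tendsto F atBot (𝓝 0) := by
    have h1 := gM_tendsto hd h (m := d - 1) le_rfl
    refine h1.comp ?_
    refine tendsto_atTop_add_const_left _ _ ?_
    exact tendsto_atTop_mono (fun x => le_max_left _ _) tendsto_neg_atBot_atTop
  rw [e, F.measure_Iic ht, hF, neg_neg, max_eq_left hz, sub_zero, HH_pos (by linarith)]

lemma exists_M (hd : 2 ≤ d) (h : IsGenerator d ψ φ) {l n : ℕ} (hl : l + n = d - 1) {s : ℝ}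
    (hs : 0 < s) :
    ∃ M : Measure (Fin (n + 1) → ℝ), M (Ici 0)ᶜ = 0 ∧
      ∀ b, M (Ici b) = HH d l ψ (s + ∑ i, max (b i) 0) := by
  obtain ⟨ν, hν, hνI⟩ := exists_nu hd h hs
  let f : (Fin n → ℝ) × ℝ → (Fin (n + 1) → ℝ) := fun p => Fin.cons (p.2 - ∑ i, p.1 i) p.1
  have hf : Measurable f := by
    refine measurable_pi_iff.2 fun i => ?_
    refine Fin.cases ?_ (fun j => ?_) i
    · simp only [f, Fin.cons_zero]; fun_prop
    · simp only [f, Fin.cons_succ]; fun_prop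
  let base := ((volume : Measure (Fin n → ℝ)).restrict (posBox 0)).prod ν
  have key : ∀ b : Fin (n + 1) → ℝ, 0 ≤ b → (base.map f) (Ici b) = HH d l ψ (s + ∑ i, b i) := by
    intro b hb
    rw [Measure.map_apply hf measurableSet_Ici, Measure.prod_apply (hf measurableSet_Ici)]
    have e : ∀ w ∈ posBox (0 : Fin n → ℝ), ν (Prod.mk w ⁻¹' (f ⁻¹' Ici b)) =
        {w : Fin n → ℝ | ∀ i, b i.succ ≤ w i}.indicator
          (fun w => HH d (l + n) ψ ((s + b 0) + ∑ i, w i)) w := by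
      intro w hw
      have hw' : 0 ≤ ∑ i, w i := Finset.sum_nonneg fun i _ => (hw i).1.le
      by_cases hwb : ∀ i, b i.succ ≤ w i
      · rw [indicator_of_mem (by exact hwb)]
        have e2 : Prod.mk w ⁻¹' (f ⁻¹' Ici b) = Ici (b 0 + ∑ i, w i) := by
          ext r
          simp only [mem_preimage, mem_Ici, f, Pi.le_def]
          constructor
          · intro hr
            have := hr 0
            simp only [Fin.cons_zero] at this
            linarith
          · intro hr i
            refine Fin.cases ?_ (fun j => ?_) i
            · simp only [Fin.cons_zero]; linarith
            · simp only [Fin.cons_succ]; exact hwb j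
        rw [e2, hνI _ (add_nonneg (hb 0) hw'), hl, add_assoc]
      · rw [indicator_of_notMem (by exact hwb)]
        have e2 : Prod.mk w ⁻¹' (f ⁻¹' Ici b) = ∅ := by
          ext r
          simp only [mem_preimage, mem_Ici, f, Pi.le_def, mem_empty_iff_false, iff_false]
          intro hr
          apply hwb
          intro i
          simpa using hr i.succ
        rw [e2, measure_empty]
    rw [setLIntegral_congr_fun (measurableSet_posBox _) e]
    have hms : MeasurableSet {w : Fin n → ℝ | ∀ i, b i.succ ≤ w i} :=
      measurableSet_Ici (a := fun i : Fin n => b i.succ)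
    rw [lintegral_indicator hms, Measure.restrict_restrict hms]
    have e3 : {w : Fin n → ℝ | ∀ i, b i.succ ≤ w i} ∩ posBox 0 = posBox (fun i => b i.succ) := by
      ext w
      simp only [posBox, mem_inter_iff, mem_ofPred_eq, Pi.zero_apply]
      exact ⟨fun hw i => ⟨(hw.2 i).1, hw.1 i⟩,
        fun hw => ⟨fun i => (hw i).2, fun i => ⟨(hw i).1, (hw i).1.le⟩⟩⟩
    have hb0 : 0 ≤ b 0 := hb 0
    have hsum : 0 ≤ ∑ i : Fin n, b i.succ := Finset.sum_nonneg fun i _ => hb _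
    rw [e3, HH_lintegral_posBox hd h n l (by omega) _ _ (by linarith) (fun i => hb _)
      (Or.inl (by linarith)), Fin.sum_univ_succ, add_assoc]
  refine ⟨(base.map f).restrict (Ici 0), ?_, fun b => ?_⟩
  · rw [Measure.restrict_apply measurableSet_Ici.compl]; simp
  · rw [Measure.restrict_apply measurableSet_Ici, Ici_inter_Ici, key _ le_sup_right]
    rfl

lemma gen_pi_Ici (k : ℕ) :
    (MeasurableSpace.pi : MeasurableSpace (Fin k → ℝ)) = MeasurableSpace.generateFrom (range Ici) := by
  have h1 : ∀ i : Fin k, MeasurableSpace.generateFrom (range (Ici : ℝ → Set ℝ))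
      = (inferInstance : MeasurableSpace ℝ) := fun i => by
    rw [← borel_eq_generateFrom_Ici, ← BorelSpace.measurable_eq]
  have h2 : ∀ i : Fin k, IsCountablySpanning (range (Ici : ℝ → Set ℝ)) := fun i =>
    ⟨fun n => Ici (-(n : ℝ)), fun n => mem_range_self _, by
      ext x; simp only [mem_iUnion, mem_Ici, mem_univ, iff_true]
      obtain ⟨n, hn⟩ := exists_nat_gt (-x)
      exact ⟨n, by linarith⟩⟩
  rw [← generateFrom_eq_pi h1 h2]
  congr 1
  ext S
  simp only [mem_image, mem_range, Set.mem_pi, mem_univ, true_imp_iff]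
  constructor
  · rintro ⟨g, hg, rfl⟩
    choose b hb using hg
    exact ⟨b, by rw [← pi_univ_Ici]; simp only [hb]⟩
  · rintro ⟨b, rfl⟩
    exact ⟨fun i => Ici (b i), fun i => ⟨b i, rfl⟩, pi_univ_Ici b⟩

lemma gen_pi_Iic (k : ℕ) :
    (MeasurableSpace.pi : MeasurableSpace (Fin k → ℝ)) = MeasurableSpace.generateFrom (range Iic) := by
  have h1 : ∀ i : Fin k, MeasurableSpace.generateFrom (range (Iic : ℝ → Set ℝ))
      = (inferInstance : MeasurableSpace ℝ) := fun i => by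
    rw [← borel_eq_generateFrom_Iic, ← BorelSpace.measurable_eq]
  have h2 : ∀ i : Fin k, IsCountablySpanning (range (Iic : ℝ → Set ℝ)) := fun i =>
    ⟨fun n => Iic (n : ℝ), fun n => mem_range_self _, by
      ext x; simp only [mem_iUnion, mem_Iic, mem_univ, iff_true]
      obtain ⟨n, hn⟩ := exists_nat_gt x
      exact ⟨n, by linarith⟩⟩
  rw [← generateFrom_eq_pi h1 h2]
  congr 1
  ext S
  simp only [mem_image, mem_range, Set.mem_pi, mem_univ, true_imp_iff]
  constructor
  · rintro ⟨g, hg, rfl⟩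
    choose b hb using hg
    exact ⟨b, by rw [← pi_univ_Iic]; simp only [hb]⟩
  · rintro ⟨b, rfl⟩
    exact ⟨fun i => Iic (b i), fun i => ⟨b i, rfl⟩, pi_univ_Iic b⟩

lemma exists_kappa (hd : 2 ≤ d) (h : IsGenerator d ψ φ) {l k : ℕ} (hl : l + k = d) (hk : 1 ≤ k) :
    ∃ κ : Kernel ℝ (Fin k → ℝ), IsMarkovKernel κ ∧ (∀ s, κ s (Ici 0)ᶜ = 0) ∧
      ∀ s, 0 < s → 0 < ψ s → ∀ b, κ s (Ici b) = HH d l ψ (s + ∑ i, max (b i) 0) / HH d l ψ s := by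
  obtain ⟨n, rfl⟩ : ∃ n, k = n + 1 := ⟨k - 1, by omega⟩
  have ex : ∀ s : ℝ, ∃ P : Measure (Fin (n + 1) → ℝ), IsProbabilityMeasure P ∧ P (Ici 0)ᶜ = 0 ∧
      (∀ b, P (Ici b) = if 0 < s ∧ HH d 0 ψ s ≠ 0 then
        HH d l ψ (s + ∑ i, max (b i) 0) / HH d l ψ s else
          Measure.dirac (0 : Fin (n + 1) → ℝ) (Ici b)) := by
    intro s
    by_cases hs : 0 < s ∧ HH d 0 ψ s ≠ 0
    · obtain ⟨M, hM0, hM⟩ := exists_M hd h (n := n) (l := l) (by omega) hs.1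
      have hψ : 0 < ψ s := by
        have := hs.2
        rw [HH_zero hd h hs.1.le] at this
        exact lt_of_not_ge fun hh => this (ENNReal.ofReal_eq_zero.2 hh)
      have hne := HH_ne_zero hd h (l := l) (by omega) hs.1 hψ
      have hnt : HH d l ψ s ≠ ⊤ := HH_ne_top hs.1
      refine ⟨(HH d l ψ s)⁻¹ • M, ⟨?_⟩, ?_, ?_⟩
      · have : M univ = HH d l ψ s := by
          rw [← union_compl_self (Ici (0 : Fin (n + 1) → ℝ)),
            measure_union disjoint_compl_right measurableSet_Ici.compl, hM0, hM]
          simp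
        rw [Measure.smul_apply, this, smul_eq_mul, ENNReal.inv_mul_cancel hne hnt]
      · simp [hM0]
      · intro b
        rw [if_pos hs, Measure.smul_apply, hM, smul_eq_mul, mul_comm, div_eq_mul_inv]
    · refine ⟨Measure.dirac 0, inferInstance, ?_, fun b => by rw [if_neg hs]⟩
      rw [Measure.dirac_apply' _ measurableSet_Ici.compl]; simp
  choose P hP1 hP2 hP3 using ex
  have hmeas : Measurable P := by
    refine Measurable.measure_of_isPiSystem_of_isProbabilityMeasure (gen_pi_Ici _) ?_ ?_
    · rintro _ ⟨a, rfl⟩ _ ⟨b, rfl⟩ _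
      exact ⟨a ⊔ b, Ici_inter_Ici.symm⟩
    · rintro _ ⟨b, rfl⟩
      simp only [hP3]
      have m0 := HH_measurable hd h (m := 0) (by omega)
      have ml := HH_measurable hd h (m := l) (by omega)
      refine Measurable.ite ?_ ?_ measurable_const
      · exact measurableSet_Ioi.inter (m0 (measurableSet_singleton 0).compl)
      · exact (ml.comp (by fun_prop)).div ml
  refine ⟨⟨P, hmeas⟩, ⟨hP1⟩, hP2, fun s hs hψ b => ?_⟩
  change P s (Ici b) = _
  rw [hP3, if_pos]
  refine ⟨hs, ?_⟩
  rw [HH_zero hd h hs.le]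
  simpa using hψ

end Ksec

section PhiSec
variable {d : ℕ} {ψ : ℝ → ℝ} {φ : ℝ → ℝ≥0∞}

lemma evalPsi_ofReal (ψ : ℝ → ℝ) {u : ℝ} (hu : 0 ≤ u) : evalPsi ψ (ENNReal.ofReal u) = ψ u := by
  simp [evalPsi, ENNReal.toReal_ofReal hu]

lemma evalPsi_top (ψ : ℝ → ℝ) : evalPsi ψ ∞ = 0 := by simp [evalPsi]

lemma evalPsi_nonneg (h : IsGenerator d ψ φ) (s : ℝ≥0∞) : 0 ≤ evalPsi ψ s := by
  unfold evalPsi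
  split_ifs
  · exact le_rfl
  · exact h.nonneg _ ENNReal.toReal_nonneg

lemma evalPsi_antitone (h : IsGenerator d ψ φ) : Antitone (evalPsi ψ) := by
  intro s t hst
  by_cases ht : t = ∞
  · subst ht; rw [evalPsi_top]; exact evalPsi_nonneg h s
  · have hs : s ≠ ∞ := ne_top_of_le_ne_top ht hst
    simp only [evalPsi, hs, ht, if_false]
    exact h.antitoneOn (mem_Ici.2 ENNReal.toReal_nonneg) (mem_Ici.2 ENNReal.toReal_nonneg)
      (ENNReal.toReal_mono ht hst)

lemma galois (h : IsGenerator d ψ φ) {y u : ℝ} (hy : y ∈ Icc (0 : ℝ) 1) (hu : 0 ≤ u) :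
    ψ u ≤ y ↔ φ y ≤ ENNReal.ofReal u := by
  rcases hy.1.eq_or_lt with rfl | hy0
  · rw [h.phi_zero]
    constructor
    · intro hle
      apply sInf_le
      change evalPsi ψ (ENNReal.ofReal u) = 0
      rw [evalPsi_ofReal ψ hu]
      exact le_antisymm hle (h.nonneg u hu)
    · intro hle
      by_contra hlt
      push Not at hlt
      have hc : ContinuousWithinAt ψ (Ioi u) u :=
        (h.continuousOn u hu).mono fun x (hx : u < x) => mem_Ici.2 (hu.trans hx.le)
      have h1 : ∀ᶠ x in 𝓝[>] u, 0 < ψ x := hc.tendsto.eventually (lt_mem_nhds hlt)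
      obtain ⟨u', h2, h3⟩ := (h1.and self_mem_nhdsWithin).exists
      have h3 : u < u' := h3
      have h4 : ENNReal.ofReal u' ≤ sInf {s : ℝ≥0∞ | evalPsi ψ s = 0} := by
        refine le_sInf fun s hs => ?_
        by_contra hcon
        push Not at hcon
        have h5 := evalPsi_antitone h hcon.le
        rw [evalPsi_ofReal ψ (hu.trans h3.le), (hs : evalPsi ψ s = 0)] at h5
        linarith
      have h6 := h4.trans hle
      rw [ENNReal.ofReal_le_ofReal_iff hu] at h6
      linarith
  · have hf := h.phi_finite y hy0
    have hp := h.psi_phi y hy0 hy.2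
    simp only [evalPsi, hf, if_false] at hp
    rw [← ENNReal.toReal_le_toReal hf ENNReal.ofReal_ne_top, ENNReal.toReal_ofReal hu]
    constructor
    · intro hle
      by_contra hlt
      push Not at hlt
      have := h.strict_anti u _ hu hlt (by rw [hp]; exact hy0)
      linarith
    · intro hle
      rw [← hp]
      exact h.antitoneOn (mem_Ici.2 ENNReal.toReal_nonneg) (mem_Ici.2 hu) hle

lemma evalPsi_eq_zero_iff (h : IsGenerator d ψ φ) (s : ℝ≥0∞) : evalPsi ψ s = 0 ↔ φ 0 ≤ s := by
  by_cases hs : s = ∞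
  · subst hs; simp [evalPsi_top]
  · have h1 := galois h (y := 0) (by simp) (ENNReal.toReal_nonneg (a := s))
    rw [ENNReal.ofReal_toReal hs] at h1
    rw [← h1]
    simp only [evalPsi, hs, if_false]
    exact ⟨fun h => h.le, fun h' => le_antisymm h' (h.nonneg _ ENNReal.toReal_nonneg)⟩

lemma phi_antitone (h : IsGenerator d ψ φ) {y y' : ℝ} (hy : y ∈ Icc (0 : ℝ) 1)
    (hy' : y' ∈ Icc (0 : ℝ) 1) (hyy : y ≤ y') : φ y' ≤ φ y := by
  by_cases ht : φ y = ∞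
  · rw [ht]; exact le_top
  · rw [← ENNReal.ofReal_toReal ht, ← galois h hy' ENNReal.toReal_nonneg]
    refine le_trans ?_ hyy
    rw [galois h hy ENNReal.toReal_nonneg, ENNReal.ofReal_toReal ht]

lemma phi_psi (h : IsGenerator d ψ φ) {u : ℝ} (hu : 0 ≤ u) (hψ : 0 < ψ u) :
    φ (ψ u) = ENNReal.ofReal u := by
  have h1 : ψ u ≤ 1 := psi_le_one h hu
  refine le_antisymm ((galois h ⟨hψ.le, h1⟩ hu).1 le_rfl) ?_
  have hf := h.phi_finite _ hψ
  have hp := h.psi_phi _ hψ h1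
  simp only [evalPsi, hf, if_false] at hp
  rw [ENNReal.ofReal_le_iff_le_toReal hf]
  by_contra hlt
  push Not at hlt
  have := h.strict_anti _ u ENNReal.toReal_nonneg hlt hψ
  linarith

lemma phi_ne_zero (h : IsGenerator d ψ φ) {y : ℝ} (hy : y ∈ Icc (0 : ℝ) 1) (h1 : y ≠ 1) :
    φ y ≠ 0 := by
  intro h0
  have := (galois h hy le_rfl).2 (by rw [h0]; simp)
  rw [h.at_zero] at this
  exact h1 (le_antisymm hy.2 this)

def Hb (d l : ℕ) (ψ : ℝ → ℝ) (s : ℝ≥0∞) : ℝ≥0∞ := if s = ∞ then 0 else HH d l ψ s.toReal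

lemma psiD_eq (l : ℕ) {s : ℝ≥0∞} (hs : s ≠ ∞) :
    psiD d l ψ s = (-1 : ℝ) ^ l * gM d l ψ s.toReal := by
  have e : (-1 : ℝ) ^ l * (-1 : ℝ) ^ l = 1 := by
    rw [← mul_pow]; simp
  simp only [psiD, hs, if_false, gM]
  rw [← mul_assoc, e, one_mul]

lemma archK_good (hd : 2 ≤ d) (h : IsGenerator d ψ φ) {l : ℕ} (hl : l ≤ d - 1)
    {x : Fin l → ℝ} (y : Fin (d - l) → ℝ)
    (hx1 : ¬ ∀ i, x i = 1) (hx2 : evalPsi ψ (∑ i, φ (x i)) ≠ 0)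
    (hs0 : 0 < (∑ i, φ (x i)).toReal) :
    ENNReal.ofReal (archK d l ψ φ x y) =
      Hb d l ψ ((∑ i, φ (x i)) + ∑ j, φ (y j)) / HH d l ψ (∑ i, φ (x i)).toReal := by
  set s := ∑ i, φ (x i) with hs
  set c := ∑ j, φ (y j) with hc
  have hst : s ≠ ∞ := by
    intro hh; rw [hh, evalPsi_top] at hx2; exact hx2 rfl
  have hψ : 0 < ψ s.toReal := by
    have h1 := evalPsi_nonneg h s
    have h2 := lt_of_le_of_ne h1 (Ne.symm hx2)
    simpa [evalPsi, hst] using h2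
  have hne := HH_ne_zero hd h hl hs0 hψ
  have hgpos : 0 < gM d l ψ s.toReal := by
    rw [HH_pos hs0] at hne
    exact lt_of_not_ge fun hh => hne (ENNReal.ofReal_eq_zero.2 hh)
  rw [archK, if_neg (by rw [← hs]; tauto)]
  rw [← hs, ← hc]
  split_ifs with hex
  · obtain ⟨t, ht1, ht2⟩ := hex
    have : Hb d l ψ (s + c) = 0 := by
      unfold Hb
      split_ifs with htop
      · rfl
      · have htt : t ≠ ∞ := ne_top_of_lt ht1
        simp only [evalPsi, htt, if_false] at ht2
        exact HH_eq_zero hd h ENNReal.toReal_nonneg ht2 hl _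
          ((ENNReal.toReal_lt_toReal htt htop).2 ht1)
    rw [this]; simp
  · by_cases htop : s + c = ∞
    · simp [psiD, Hb, htop]
    · rw [psiD_eq l htop, psiD_eq l hst, mul_div_mul_left _ _ (by simp), Hb, if_neg htop,
        HH_pos hs0, HH_pos, ENNReal.ofReal_div_of_pos hgpos]
      have : s.toReal ≤ (s + c).toReal := ENNReal.toReal_mono htop le_self_add
      linarith

lemma lowerBox_eq {k : ℕ} (y : Fin k → ℝ) : lowerBox y = Iic y := by
  ext t; simp [lowerBox, Pi.le_def]

/-- Uniqueness. -/
lemma ext_boxes {l k : ℕ} (P Q : Measure ((Fin l → ℝ) × (Fin k → ℝ))) [IsProbabilityMeasure P]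
    [IsProbabilityMeasure Q]
    (hPQ : ∀ x ∈ unitCube l, ∀ y ∈ unitCube k, P (lowerBox x ×ˢ lowerBox y)
      = Q (lowerBox x ×ˢ lowerBox y))
    (h1 : P (lowerBox (fun _ => 1) ×ˢ lowerBox (fun _ => 1)) = 1)
    (h0 : ∀ x ∈ unitCube l, ∀ y ∈ unitCube k, ((∃ i, x i = 0) ∨ (∃ j, y j = 0)) →
      P (lowerBox x ×ˢ lowerBox y) = 0) : P = Q := by
  have one_mem : ∀ n, (fun _ => 1 : Fin n → ℝ) ∈ unitCube n := fun n i => by simp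
  have main : ∀ x y, ∀ R : Measure ((Fin l → ℝ) × (Fin k → ℝ)), IsProbabilityMeasure R →
      R (lowerBox (fun _ => 1) ×ˢ lowerBox (fun _ => 1)) = 1 →
      (∀ x ∈ unitCube l, ∀ y ∈ unitCube k, ((∃ i, x i = 0) ∨ (∃ j, y j = 0)) →
        R (lowerBox x ×ˢ lowerBox y) = 0) →
      R (Iic x ×ˢ Iic y) = R (lowerBox (fun i => max 0 (min (x i) 1)) ×ˢ
        lowerBox (fun i => max 0 (min (y i) 1))) := by
    intro x y R hR hR1 hR0
    have hms : MeasurableSet ((lowerBox (fun _ : Fin l => (1 : ℝ))) ×ˢ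
        (lowerBox (fun _ : Fin k => (1 : ℝ)))) := by
      rw [lowerBox_eq, lowerBox_eq]; exact measurableSet_Iic.prod measurableSet_Iic
    have hae : ∀ᵐ p ∂(R), p ∈ ((lowerBox (fun _ : Fin l => (1 : ℝ))) ×ˢ
        (lowerBox (fun _ : Fin k => (1 : ℝ)))) := (prob_compl_eq_zero_iff hms).2 hR1
    have hcl : ∀ n (x : Fin n → ℝ), (fun i => max 0 (min (x i) 1)) ∈ unitCube n := by
      intro n x i
      exact ⟨le_max_left _ _, max_le zero_le_one (min_le_right _ _)⟩
    by_cases hneg : (∃ i, x i < 0) ∨ (∃ j, y j < 0)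
    · have hz := hR0 _ (hcl l x) _ (hcl k y) (by
        rcases hneg with ⟨i, hi⟩ | ⟨j, hj⟩
        · left; exact ⟨i, max_eq_left ((min_le_left _ _).trans hi.le)⟩
        · right; exact ⟨j, max_eq_left ((min_le_left _ _).trans hj.le)⟩)
      rw [hz]
      rw [← nonpos_iff_eq_zero, ← hz]
      refine measure_mono_ae ?_
      filter_upwards [hae] with p hp hpxy
      exact ⟨fun i => le_max_of_le_right (le_min (hpxy.1 i) (hp.1 i)),
        fun i => le_max_of_le_right (le_min (hpxy.2 i) (hp.2 i))⟩
    · push Not at hneg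
      refine measure_congr ?_
      filter_upwards [hae] with p hp
      apply propext
      constructor
      · intro hpxy
        exact ⟨fun i => le_max_of_le_right (le_min (hpxy.1 i) (hp.1 i)),
          fun i => le_max_of_le_right (le_min (hpxy.2 i) (hp.2 i))⟩
      · intro hpxy
        refine ⟨fun i => (hpxy.1 i).trans (max_le (hneg.1 i) (min_le_left _ _)),
          fun i => (hpxy.2 i).trans (max_le (hneg.2 i) (min_le_left _ _))⟩
  have span : ∀ n, IsCountablySpanning (range (Iic : (Fin n → ℝ) → Set (Fin n → ℝ))) := fun n =>
    ⟨fun m => Iic (fun _ => (m : ℝ)), fun m => mem_range_self _, by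
      ext x; simp only [mem_iUnion, mem_Iic, mem_univ, iff_true, Pi.le_def]
      obtain ⟨m, hm⟩ := exists_nat_gt (∑ i, |x i|)
      refine ⟨m, fun i => ?_⟩
      have h1 : |x i| ≤ ∑ i, |x i| :=
        Finset.single_le_sum (f := fun i => |x i|) (fun i _ => abs_nonneg _) (Finset.mem_univ i)
      linarith [le_abs_self (x i)]⟩
  have pisys : ∀ n, IsPiSystem (range (Iic : (Fin n → ℝ) → Set (Fin n → ℝ))) := by
    rintro n _ ⟨a, rfl⟩ _ ⟨b, rfl⟩ _
    exact ⟨a ⊓ b, Iic_inter_Iic.symm⟩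
  refine ext_of_generate_finite _
    (generateFrom_eq_prod (gen_pi_Iic l).symm (gen_pi_Iic k).symm (span l) (span k)).symm
    ((pisys l).prod (pisys k)) ?_ (by simp)
  rintro _ ⟨_, ⟨x, rfl⟩, _, ⟨y, rfl⟩, rfl⟩
  have hcl : ∀ n (x : Fin n → ℝ), (fun i => max 0 (min (x i) 1)) ∈ unitCube n := by
    intro n x i
    exact ⟨le_max_left _ _, max_le zero_le_one (min_le_right _ _)⟩
  rw [main x y P inferInstance h1 h0, main x y Q inferInstance
    (by rw [← hPQ _ (one_mem l) _ (one_mem k)]; exact h1)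
    (fun x hx y hy hh => by rw [← hPQ _ hx _ hy]; exact h0 x hx y hy hh)]
  exact hPQ _ (hcl l x) _ (hcl k y)

lemma sum_ne_ae {l : ℕ} (hl : 1 ≤ l) (t : ℝ) : ∀ᵐ u : Fin l → ℝ, ∑ i, u i ≠ t := by
  let A : AffineSubspace ℝ (Fin l → ℝ) :=
    { carrier := {u | ∑ i, u i = t}
      smul_vsub_vadd_mem' := by
        intro c p q r hp hq hr
        change ∑ i, (c • (p - q) + r) i = t
        simp only [Pi.add_apply, Pi.smul_apply, Pi.sub_apply, smul_eq_mul,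
          Finset.sum_add_distrib, ← Finset.mul_sum, Finset.sum_sub_distrib]
        have hp : ∑ i, p i = t := hp
        have hq : ∑ i, q i = t := hq
        have hr : ∑ i, r i = t := hr
        rw [hp, hq, hr]; ring }
  have hA : A ≠ ⊤ := by
    intro htop
    have h1 : (Function.update (fun _ => 0) (⟨0, hl⟩ : Fin l) (t + 1) : Fin l → ℝ) ∈ A := by
      rw [htop]; trivial
    have h2 : ∑ i, (Function.update (fun _ => 0) (⟨0, hl⟩ : Fin l) (t + 1) : Fin l → ℝ) i = t := h1
    rw [Finset.sum_update_of_mem (Finset.mem_univ _)] at h2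
    simp at h2
  have := Measure.addHaar_affineSubspace (volume : Measure (Fin l → ℝ)) A hA
  rw [ae_iff]
  simp only [ne_eq, not_not]
  exact this

end PhiSec

section MainSec
variable {d : ℕ} {ψ : ℝ → ℝ} {φ : ℝ → ℝ≥0∞}

def PsiMap (ψ : ℝ → ℝ) {k : ℕ} (z : Fin k → ℝ) : Fin k → ℝ := fun j => ψ (max (z j) 0)

lemma PsiMap_measurable (h : IsGenerator d ψ φ) (k : ℕ) :
    Measurable (PsiMap ψ : (Fin k → ℝ) → (Fin k → ℝ)) := by
  have : Antitone (fun z : ℝ => ψ (max z 0)) := by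
    intro a b hab
    exact h.antitoneOn (mem_Ici.2 (le_max_right _ _)) (mem_Ici.2 (le_max_right _ _))
      (max_le_max_right 0 hab)
  exact measurable_pi_iff.2 fun i => this.measurable.comp (measurable_pi_apply i)

def clampSum (φ : ℝ → ℝ≥0∞) {l : ℕ} (x : Fin l → ℝ) : ℝ≥0∞ := ∑ i, φ (max 0 (min (x i) 1))

lemma clampSum_eq {l : ℕ} {x : Fin l → ℝ} (hx : x ∈ unitCube l) :
    clampSum φ x = ∑ i, φ (x i) := by
  refine Finset.sum_congr rfl fun i _ => ?_
  rw [min_eq_left (hx i).2, max_eq_right (hx i).1]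

lemma clampSum_measurable (h : IsGenerator d ψ φ) (l : ℕ) :
    Measurable (clampSum φ : (Fin l → ℝ) → ℝ≥0∞) := by
  have hcl : ∀ t : ℝ, max 0 (min t 1) ∈ Icc (0 : ℝ) 1 := fun t =>
    ⟨le_max_left _ _, max_le zero_le_one (min_le_right _ _)⟩
  have : Antitone (fun t : ℝ => φ (max 0 (min t 1))) := by
    intro a b hab
    exact phi_antitone h (hcl a) (hcl b) (max_le_max_left 0 (min_le_min_right 1 hab))
  exact Finset.measurable_sum _ fun i _ => this.measurable.comp (measurable_pi_apply i)

def goodSet (ψ : ℝ → ℝ) (φ : ℝ → ℝ≥0∞) (l : ℕ) : Set (Fin l → ℝ) :=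
  unitCube l ∩ ({x | ∀ i, x i = 1}ᶜ ∩ {x | evalPsi ψ (clampSum φ x) = 0}ᶜ)

lemma goodSet_measurable (h : IsGenerator d ψ φ) (l : ℕ) : MeasurableSet (goodSet ψ φ l) := by
  have h1 : unitCube l = Set.pi univ (fun _ => Icc (0 : ℝ) 1) := by
    ext x; exact ⟨fun hh i _ => hh i, fun hh i => hh i trivial⟩
  have h2 : {x : Fin l → ℝ | ∀ i, x i = 1} = {fun _ => 1} := by
    ext x
    simp only [mem_ofPred_eq, mem_singleton_iff]
    exact ⟨fun hh => funext hh, fun hh i => by rw [hh]⟩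
  refine MeasurableSet.inter ?_ (MeasurableSet.inter ?_ ?_)
  · rw [h1]; exact MeasurableSet.univ_pi fun _ => measurableSet_Icc
  · rw [h2]; exact (measurableSet_singleton _).compl
  · exact (((evalPsi_antitone h).measurable.comp (clampSum_measurable h l))
      (measurableSet_singleton 0)).compl

/-- Preimage of a box under `PsiMap`. -/
lemma PsiMap_mem (h : IsGenerator d ψ φ) {k : ℕ} {y : Fin k → ℝ} (hy : y ∈ unitCube k)
    {z : Fin k → ℝ} (hz : ∀ i, 0 ≤ z i) :
    PsiMap ψ z ∈ lowerBox y ↔ ∀ i, φ (y i) ≤ ENNReal.ofReal (z i) := by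
  simp only [PsiMap, lowerBox, mem_ofPred_eq]
  refine forall_congr' fun i => ?_
  rw [max_eq_left (hz i), galois h (hy i) (hz i)]

lemma sum_toReal {k : ℕ} {f : Fin k → ℝ≥0∞} (hf : ∀ j, f j ≠ ∞) :
    (∑ j, f j).toReal = ∑ j, (f j).toReal := ENNReal.toReal_sum fun j _ => hf j

lemma good_pos (h : IsGenerator d ψ φ) {l : ℕ} {x : Fin l → ℝ} (hx : x ∈ unitCube l)
    (hx1 : ¬ ∀ i, x i = 1) (hx2 : evalPsi ψ (∑ i, φ (x i)) ≠ 0) :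
    0 < (∑ i, φ (x i)).toReal ∧ 0 < ψ (∑ i, φ (x i)).toReal := by
  have hst : ∑ i, φ (x i) ≠ ∞ := by
    intro hh; rw [hh, evalPsi_top] at hx2; exact hx2 rfl
  constructor
  · push Not at hx1
    obtain ⟨i, hi⟩ := hx1
    refine ENNReal.toReal_pos ?_ hst
    intro h0
    exact phi_ne_zero h (hx i) hi ((Finset.sum_eq_zero_iff.1 h0) i (Finset.mem_univ i))
  · have h2 := lt_of_le_of_ne (evalPsi_nonneg h _) (Ne.symm hx2)
    simpa [evalPsi, hst] using h2

lemma exists_K (hd : 2 ≤ d) (h : IsGenerator d ψ φ) {l : ℕ} (hl2 : l ≤ d - 1) :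
    ∃ K : Kernel (Fin l → ℝ) (Fin (d - l) → ℝ), IsMarkovKernel K ∧
      ∀ x ∈ unitCube l, ∀ y ∈ unitCube (d - l),
        K x (lowerBox y) = ENNReal.ofReal (archK d l ψ φ x y) := by
  obtain ⟨κ, hκ1, hκ2, hκ3⟩ := exists_kappa hd h (l := l) (k := d - l) (by omega) (by omega)
  have hPm := PsiMap_measurable h (d - l)
  have hsm : Measurable (fun x : Fin l → ℝ => (clampSum φ x).toReal) :=
    (clampSum_measurable h l).ennreal_toReal
  have hM1 : IsMarkovKernel ((κ.comap _ hsm).map (PsiMap ψ)) := Kernel.IsMarkovKernel.map _ hPm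
  have hM2 : IsMarkovKernel (Kernel.const (Fin l → ℝ) (Measure.dirac (0 : Fin (d - l) → ℝ))) :=
    inferInstance
  refine ⟨Kernel.piecewise (goodSet_measurable h l) ((κ.comap _ hsm).map (PsiMap ψ))
    (Kernel.const _ (Measure.dirac 0)), inferInstance, ?_⟩
  intro x hx y hy
  have hbm : MeasurableSet (lowerBox y) := by rw [lowerBox_eq]; exact measurableSet_Iic
  rw [Kernel.piecewise_apply]
  split_ifs with hg
  · obtain ⟨-, hx1, hx2⟩ := hg
    simp only [mem_compl_iff, mem_ofPred_eq] at hx1 hx2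
    rw [clampSum_eq hx] at hx2
    obtain ⟨hs0, hψ⟩ := good_pos h hx hx1 hx2
    have hst : ∑ i, φ (x i) ≠ ∞ := by
      intro hh; rw [hh, evalPsi_top] at hx2; exact hx2 rfl
    rw [archK_good hd h hl2 y hx1 hx2 hs0, Kernel.map_apply' _ hPm _ hbm, Kernel.comap_apply',
      clampSum_eq hx]
    set s := ∑ i, φ (x i)
    have hae : ∀ᵐ z ∂(κ s.toReal), z ∈ Ici 0 := hκ2 _
    by_cases hfin : ∀ j, φ (y j) ≠ ∞
    · have e1 : κ s.toReal (PsiMap ψ ⁻¹' lowerBox y) = κ s.toReal (Ici fun j => (φ (y j)).toReal) := by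
        refine measure_congr ?_
        filter_upwards [hae] with z hz
        apply propext
        change PsiMap ψ z ∈ lowerBox y ↔ _
        rw [PsiMap_mem h hy hz]
        refine forall_congr' fun j => ?_
        rw [ENNReal.le_ofReal_iff_toReal_le (hfin j) (hz j)]
      have hct : ∑ j, φ (y j) ≠ ∞ := ENNReal.sum_ne_top.2 fun j _ => hfin j
      rw [e1, hκ3 _ hs0 hψ, Hb, if_neg (ENNReal.add_ne_top.2 ⟨hst, hct⟩),
        ENNReal.toReal_add hst hct, sum_toReal hfin]
      simp only [max_eq_left ENNReal.toReal_nonneg]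
    · push Not at hfin
      obtain ⟨j, hj⟩ := hfin
      have hct : ∑ j, φ (y j) = ∞ := ENNReal.sum_eq_top.2 ⟨j, Finset.mem_univ j, hj⟩
      have e1 : κ s.toReal (PsiMap ψ ⁻¹' lowerBox y) = 0 := by
        rw [measure_eq_zero_iff_ae_notMem]
        filter_upwards [hae] with z hz hmem
        have := (PsiMap_mem h hy hz).1 hmem j
        rw [hj] at this
        simp at this
      rw [e1, Hb, if_pos (by rw [hct]; simp)]
      simp
  · have hcase : (∀ i, x i = 1) ∨ evalPsi ψ (∑ i, φ (x i)) = 0 := by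
      by_contra hcon
      push Not at hcon
      apply hg
      refine ⟨hx, ?_, ?_⟩
      · simp only [mem_compl_iff, mem_ofPred_eq]; push Not; exact hcon.1
      · simp only [mem_compl_iff, mem_ofPred_eq]; rw [clampSum_eq hx]; exact hcon.2
    rw [archK, if_pos hcase, Kernel.const_apply, Measure.dirac_apply' _ hbm,
      indicator_of_mem]
    · simp
    · exact fun j => (hy j).1

def Lam (d l : ℕ) (ψ : ℝ → ℝ) : Measure (Fin l → ℝ) :=
  (((volume : Measure (Fin l → ℝ)).restrict (posBox 0)).withDensity
    (fun u => HH d l ψ (∑ i, u i))).map (PsiMap ψ)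

lemma Lam_prob (hd : 2 ≤ d) (h : IsGenerator d ψ φ) {l : ℕ} (hl2 : l ≤ d - 1) :
    IsProbabilityMeasure (Lam d l ψ) := by
  constructor
  rw [Lam, Measure.map_apply (PsiMap_measurable h l) MeasurableSet.univ, preimage_univ,
    withDensity_apply _ MeasurableSet.univ, Measure.restrict_univ]
  have := HH_lintegral_posBox hd h l 0 (by omega) 0 0 le_rfl (fun _ => le_rfl) (Or.inr rfl)
  simp only [zero_add, Pi.zero_apply, Finset.sum_const_zero] at this
  rw [this, HH_zero hd h le_rfl, h.at_zero]
  simp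

lemma key_integrand (hd : 2 ≤ d) (h : IsGenerator d ψ φ) {l : ℕ} (hl1 : 1 ≤ l) (hl2 : l ≤ d - 1)
    (K : Kernel (Fin l → ℝ) (Fin (d - l) → ℝ))
    (hK : ∀ x ∈ unitCube l, ∀ y ∈ unitCube (d - l),
        K x (lowerBox y) = ENNReal.ofReal (archK d l ψ φ x y))
    {y : Fin (d - l) → ℝ} (hy : y ∈ unitCube (d - l)) {u : Fin l → ℝ} (hu : ∀ i, 0 < u i)
    (hne : ∑ i, u i ≠ (φ 0).toReal) :
    HH d l ψ (∑ i, u i) * K (PsiMap ψ u) (lowerBox y)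
      = Hb d l ψ (ENNReal.ofReal (∑ i, u i) + ∑ j, φ (y j)) := by
  have hne' : (Finset.univ : Finset (Fin l)).Nonempty := ⟨⟨0, hl1⟩, Finset.mem_univ _⟩
  have hS : 0 < ∑ i, u i := Finset.sum_pos (fun i _ => hu i) hne'
  set S := ∑ i, u i with hSdef
  by_cases hψ : 0 < ψ S
  · have hle : ∀ i, u i ≤ S := fun i =>
      Finset.single_le_sum (f := u) (fun i _ => (hu i).le) (Finset.mem_univ i)
    have hψi : ∀ i, 0 < ψ (u i) := fun i =>
      hψ.trans_le (h.antitoneOn (mem_Ici.2 (hu i).le) (mem_Ici.2 hS.le) (hle i))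
    have hPu : PsiMap ψ u = fun i => ψ (u i) := by
      funext i; simp [PsiMap, max_eq_left (hu i).le]
    have hcube : PsiMap ψ u ∈ unitCube l := by
      rw [hPu]
      exact fun i => ⟨(hψi i).le, psi_le_one h (hu i).le⟩
    have hsum : ∑ i, φ (PsiMap ψ u i) = ENNReal.ofReal S := by
      rw [hPu, hSdef, ENNReal.ofReal_sum_of_nonneg fun i _ => (hu i).le]
      exact Finset.sum_congr rfl fun i _ => phi_psi h (hu i).le (hψi i)
    have hx1 : ¬ ∀ i, PsiMap ψ u i = 1 := by
      intro hall
      have h1 := hall ⟨0, hl1⟩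
      rw [hPu] at h1
      have h2 := h.strict_anti 0 _ le_rfl (hu ⟨0, hl1⟩) (hψi _)
      rw [h.at_zero] at h2
      simp only at h1
      linarith
    have hx2 : evalPsi ψ (∑ i, φ (PsiMap ψ u i)) ≠ 0 := by
      rw [hsum, evalPsi_ofReal ψ hS.le]; exact hψ.ne'
    have e := archK_good hd h hl2 y hx1 hx2 (by rw [hsum, ENNReal.toReal_ofReal hS.le]; exact hS)
    rw [hK _ hcube y hy, e, hsum, ENNReal.toReal_ofReal hS.le]
    exact ENNReal.mul_div_cancel (HH_ne_zero hd h hl2 hS hψ) (HH_ne_top hS)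
  · have hψ0 : ψ S = 0 := le_antisymm (not_lt.1 hψ) (h.nonneg S hS.le)
    have h1 : φ 0 ≤ ENNReal.ofReal S := by
      rw [← evalPsi_eq_zero_iff h, evalPsi_ofReal ψ hS.le, hψ0]
    have hft : φ 0 ≠ ∞ := ne_top_of_le_ne_top ENNReal.ofReal_ne_top h1
    have h2 : (φ 0).toReal < S := by
      refine lt_of_le_of_ne ?_ (Ne.symm hne)
      rwa [ENNReal.le_ofReal_iff_toReal_le hft hS.le] at h1
    have h3 : ψ (φ 0).toReal = 0 := by
      have := (evalPsi_eq_zero_iff h (φ 0)).2 le_rfl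
      simpa [evalPsi, hft] using this
    have hz := HH_eq_zero hd h ENNReal.toReal_nonneg h3 hl2
    rw [hz S h2, zero_mul, Hb]
    split_ifs with htop
    · rfl
    · symm
      apply hz
      refine h2.trans_le ?_
      have := ENNReal.toReal_mono htop (le_self_add : ENNReal.ofReal S ≤ ENNReal.ofReal S + ∑ j, φ (y j))
      rwa [ENNReal.toReal_ofReal hS.le] at this

lemma box_integral (hd : 2 ≤ d) (h : IsGenerator d ψ φ) {l : ℕ} (hl1 : 1 ≤ l) (hl2 : l ≤ d - 1)
    (K : Kernel (Fin l → ℝ) (Fin (d - l) → ℝ)) [IsMarkovKernel K]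
    (hK : ∀ x ∈ unitCube l, ∀ y ∈ unitCube (d - l),
        K x (lowerBox y) = ENNReal.ofReal (archK d l ψ φ x y))
    {x : Fin l → ℝ} (hx : x ∈ unitCube l)
    {y : Fin (d - l) → ℝ} (hy : y ∈ unitCube (d - l)) :
    (Lam d l ψ ⊗ₘ K) (lowerBox x ×ˢ lowerBox y)
      = ENNReal.ofReal (evalPsi ψ ((∑ i, φ (x i)) + ∑ j, φ (y j))) := by
  have := Lam_prob hd h hl2
  have hbx : MeasurableSet (lowerBox x) := by rw [lowerBox_eq]; exact measurableSet_Iic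
  have hby : MeasurableSet (lowerBox y) := by rw [lowerBox_eq]; exact measurableSet_Iic
  have hPm := PsiMap_measurable h l
  have hHm : Measurable (fun u : Fin l → ℝ => HH d l ψ (∑ i, u i)) :=
    (HH_measurable hd h hl2).comp (by fun_prop)
  have hKm : Measurable (fun a => K a (lowerBox y)) := K.measurable_coe hby
  have hKm' : Measurable (fun u => K (PsiMap ψ u) (lowerBox y)) := hKm.comp hPm
  rw [Measure.compProd_apply_prod hbx hby, Lam, setLIntegral_map hbx hKm hPm,
    setLIntegral_withDensity_eq_setLIntegral_mul _ hHm hKm' (hPm hbx),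
    Measure.restrict_restrict (hPm hbx)]
  have hae : ∀ᵐ u ∂((volume : Measure (Fin l → ℝ)).restrict (PsiMap ψ ⁻¹' lowerBox x ∩ posBox 0)),
      ((fun u : Fin l → ℝ => HH d l ψ (∑ i, u i)) *
        fun u => K (PsiMap ψ u) (lowerBox y)) u =
        Hb d l ψ (ENNReal.ofReal (∑ i, u i) + ∑ j, φ (y j)) := by
    rw [ae_restrict_iff' ((hPm hbx).inter (measurableSet_posBox _))]
    filter_upwards [sum_ne_ae hl1 (φ 0).toReal] with u hu hmem
    exact key_integrand hd h hl1 hl2 K hK hy (fun i => (hmem.2 i).1) hu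
  refine (lintegral_congr_ae hae).trans ?_
  by_cases hct : ∑ j, φ (y j) = ∞
  · rw [hct]; simp [Hb, evalPsi]
  by_cases hfin : ∀ i, φ (x i) ≠ ∞
  · have hset : PsiMap ψ ⁻¹' lowerBox x ∩ posBox 0 = posBox (fun i => (φ (x i)).toReal) := by
      ext u
      constructor
      · rintro ⟨h1, h2⟩ i
        have h3 := (PsiMap_mem h hx (fun i => (h2 i).1.le)).1 h1 i
        rw [ENNReal.le_ofReal_iff_toReal_le (hfin i) (h2 i).1.le] at h3
        exact ⟨(h2 i).1, h3⟩
      · intro h1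
        refine ⟨(PsiMap_mem h hx (fun i => (h1 i).1.le)).2 fun i => ?_,
          fun i => ⟨(h1 i).1, (h1 i).1.le⟩⟩
        rw [ENNReal.le_ofReal_iff_toReal_le (hfin i) (h1 i).1.le]
        exact (h1 i).2
    have hst : ∑ i, φ (x i) ≠ ∞ := ENNReal.sum_ne_top.2 fun j _ => hfin j
    rw [hset]
    have hint := HH_lintegral_posBox hd h l 0 (by omega) (∑ j, φ (y j)).toReal
      (fun i => (φ (x i)).toReal) ENNReal.toReal_nonneg (fun _ => ENNReal.toReal_nonneg)
      (Or.inr rfl)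
    rw [zero_add, ← sum_toReal hfin, ← ENNReal.toReal_add hct hst,
      HH_zero hd h ENNReal.toReal_nonneg, add_comm (∑ j, φ (y j))] at hint
    rw [evalPsi, if_neg (ENNReal.add_ne_top.2 ⟨hst, hct⟩), ← hint]
    refine setLIntegral_congr_fun (measurableSet_posBox _) fun u hu => ?_
    have hu0 : 0 ≤ ∑ i, u i := Finset.sum_nonneg fun i _ => (hu i).1.le
    simp only [Hb]
    rw [if_neg (ENNReal.add_ne_top.2 ⟨ENNReal.ofReal_ne_top, hct⟩),
      ENNReal.toReal_add ENNReal.ofReal_ne_top hct, ENNReal.toReal_ofReal hu0, add_comm]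
  · push Not at hfin
    obtain ⟨i, hi⟩ := hfin
    have hst : ∑ i, φ (x i) = ∞ := ENNReal.sum_eq_top.2 ⟨i, Finset.mem_univ i, hi⟩
    have hset : PsiMap ψ ⁻¹' lowerBox x ∩ posBox 0 = ∅ := by
      ext u
      simp only [mem_inter_iff, mem_empty_iff_false, iff_false]
      rintro ⟨h1, h2⟩
      have h3 := (PsiMap_mem h hx (fun i => (h2 i).1.le)).1 h1 i
      rw [hi] at h3
      simp at h3
    rw [hset, hst]
    simp [evalPsi]

end MainSec

/-- **Theorem 3.1** (Markov kernels of multivariate Archimedean copulas).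
If `C_ψ` is a `d`-dimensional Archimedean copula with generator `ψ` (its measure `μ`
being characterized by `μ([0,x]×[0,y]) = ψ(Σᵢφ(xᵢ) + Σⱼφ(yⱼ))`), and `1 ≤ ℓ ≤ d-1`,
then the explicit formula `archK` extends to a Markov kernel from `[0,1]^ℓ` to
`[0,1]^{d-ℓ}` which is a version of the `ℓ`-Markov kernel of `C_ψ`. -/
theorem arch_markov_kernel_representation
    (d l : ℕ) (hd : 2 ≤ d) (hl1 : 1 ≤ l) (hl2 : l ≤ d - 1)
    (ψ : ℝ → ℝ) (φ : ℝ → ℝ≥0∞) (hgen : IsGenerator d ψ φ)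
    (μ : Measure ((Fin l → ℝ) × (Fin (d - l) → ℝ))) (hprob : IsProbabilityMeasure μ)
    (hμ : ∀ x ∈ unitCube l, ∀ y ∈ unitCube (d - l),
      μ (lowerBox x ×ˢ lowerBox y)
        = ENNReal.ofReal (evalPsi ψ ((∑ i, φ (x i)) + ∑ j, φ (y j)))) :
    ∃ K : Kernel (Fin l → ℝ) (Fin (d - l) → ℝ), IsMarkovKernel K ∧
      IsDisintegration μ K ∧
      ∀ x ∈ unitCube l, ∀ y ∈ unitCube (d - l),
        K x (lowerBox y) = ENNReal.ofReal (archK d l ψ φ x y) := by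
  obtain ⟨K, hKM, hK⟩ := exists_K hd hgen hl2
  refine ⟨K, hKM, ?_, hK⟩
  have hΛ := Lam_prob hd hgen hl2
  have hzero : ∀ s : ℝ≥0∞, φ 0 ≤ s → ENNReal.ofReal (evalPsi ψ s) = 0 := fun s hs => by
    rw [(evalPsi_eq_zero_iff hgen s).2 hs]; simp
  have hle : ∀ {n : ℕ} (z : Fin n → ℝ) (i : Fin n), z i = 0 → φ 0 ≤ ∑ i, φ (z i) := by
    intro n z i hi
    rw [← hi]
    exact Finset.single_le_sum (f := fun i => φ (z i)) (fun _ _ => zero_le)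
      (Finset.mem_univ i)
  have hμeq : μ = Lam d l ψ ⊗ₘ K := by
    refine ext_boxes μ _ ?_ ?_ ?_
    · intro x hx y hy
      rw [hμ x hx y hy, box_integral hd hgen hl1 hl2 K hK hx hy]
    · rw [hμ _ (fun i => by simp) _ (fun i => by simp)]
      simp [hgen.phi_one, evalPsi, hgen.at_zero]
    · intro x hx y hy hxy
      rw [hμ x hx y hy]
      apply hzero
      rcases hxy with ⟨i, hi⟩ | ⟨j, hj⟩
      · exact (hle x i hi).trans le_self_add
      · exact (hle y j hj).trans le_add_self
  have hfst : μ.map Prod.fst = Lam d l ψ := by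
    have h1 : (Lam d l ψ ⊗ₘ K).fst = Lam d l ψ := Measure.fst_compProd _ _
    rw [← hμeq] at h1
    exact h1
  intro G hG
  rw [hfst]
  conv_lhs => rw [hμeq]
  exact Measure.compProd_apply hG
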